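/- Let u : Ω_ε → ℝ be a bounded Borel measurable function with u > 0 on Ω_ε satisfying the DPP u(x) = (α/2)(sup_{B_ε(x)} u + inf_{B_ε(x)} u) + β ⨍_{B_ε(x)} u(y) dy + ε² f(x) for all x ∈ Ω, where f : Ω → ℝ is bounded Borel measurable with f > 0. If B_R(z) ⊂ Ω for some R > 0 and x, y ∈ B_R(z) satisfy |x − y| ≤ 10ε, then u(x) ≥ (α/2)^{20} u(y). -/

import Mathlib

open MeasureTheory Metric Set Filter ProbabilityTheory

noncomputable section

/-- Euclidean space `ℝⁿ`. -/
abbrev En (n : ℕ) := EuclideanSpace ℝ (Fin n)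

/-- The boundary strip `Γ_ε = {x ∈ ℝⁿ \ Ω : dist(x, ∂Ω) ≤ ε}`. -/
def bdryStrip (n : ℕ) (Ω : Set (En n)) (ε : ℝ) : Set (En n) :=
  {x | x ∉ Ω ∧ Metric.infDist x (frontier Ω) ≤ ε}

/-- The dynamic programming principle (DPP) with running payoff `f`:
`u x = (α/2)(sup_{B_ε(x)} u + inf_{B_ε(x)} u) + β ⨍_{B_ε(x)} u + ε² f x` for all `x ∈ Ω`. -/
def SatisfiesDPP (n : ℕ) (α β ε : ℝ) (Ω : Set (En n)) (f u : En n → ℝ) : Prop :=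
  ∀ x ∈ Ω, u x =
    α / 2 * (sSup (u '' Metric.ball x ε) + sInf (u '' Metric.ball x ε))
      + β * (⨍ y in Metric.ball x ε, u y) + ε ^ 2 * f x

theorem IsPreconnected.exists_mem_frontier {X : Type*} [TopologicalSpace X] {s t : Set X}
    (hs : IsPreconnected s) (hst : (s ∩ t).Nonempty) (hst' : (s ∩ tᶜ).Nonempty) :
    ∃ q ∈ s, q ∈ frontier t := by
  by_contra! h
  obtain ⟨a, has, hat⟩ := hst
  obtain ⟨b, hbs, hbt⟩ := hst'
  have hcover : s ⊆ interior t ∪ (closure t)ᶜ := fun q hq => by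
    by_cases hqi : q ∈ interior t
    · exact Or.inl hqi
    · exact Or.inr fun hqc => h q hq ⟨hqc, hqi⟩
  have ha : a ∈ interior t := (hcover has).resolve_right fun hc => hc (subset_closure hat)
  have hb : b ∈ (closure t)ᶜ := (hcover hbs).resolve_left fun hi => hbt (interior_subset hi)
  obtain ⟨q, -, hqi, hqc⟩ := hs _ _ isOpen_interior isClosed_closure.isOpen_compl hcover
    ⟨a, has, ha⟩ ⟨b, hbs, hb⟩
  exact hqc (subset_closure (interior_subset hqi))

theorem ball_subset_union_bdryStrip {n : ℕ} {Ω : Set (En n)} {ε : ℝ} {x : En n} (hx : x ∈ Ω) :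
    Metric.ball x ε ⊆ Ω ∪ bdryStrip n Ω ε := by
  intro w hw
  by_cases hwΩ : w ∈ Ω
  · exact Or.inl hwΩ
  refine Or.inr ⟨hwΩ, ?_⟩
  have hseg : IsPreconnected (segment ℝ x w) := (convex_segment x w).isPreconnected
  obtain ⟨q, hq, hqf⟩ := hseg.exists_mem_frontier
    ⟨x, left_mem_segment ℝ x w, hx⟩ ⟨w, right_mem_segment ℝ x w, hwΩ⟩
  have hqw : dist w q ≤ dist w x := by
    have h := dist_add_dist_of_mem_segment hq
    rw [dist_comm w q, dist_comm w x]
    linarith [dist_nonneg (x := x) (y := q)]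
  exact (Metric.infDist_le_dist_of_mem hqf).trans (hqw.trans (Metric.mem_ball.1 hw).le)

theorem SatisfiesDPP.mul_le_of_mem_ball {n : ℕ} {Ω : Set (En n)} {α β ε : ℝ}
    {f u : En n → ℝ} (hudpp : SatisfiesDPP n α β ε Ω f u) (hα : 0 ≤ α) (hβ : 0 ≤ β)
    (hf : ∀ x ∈ Ω, 0 ≤ f x) (hubdd : ∃ M, ∀ x ∈ Ω ∪ bdryStrip n Ω ε, |u x| ≤ M)
    (hu : ∀ x ∈ Ω ∪ bdryStrip n Ω ε, 0 ≤ u x) {x y : En n} (hx : x ∈ Ω)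
    (hy : y ∈ Metric.ball x ε) : α / 2 * u y ≤ u x := by
  obtain ⟨M, hM⟩ := hubdd
  have hsub := ball_subset_union_bdryStrip (ε := ε) hx
  have hsup : u y ≤ sSup (u '' Metric.ball x ε) := by
    refine le_csSup ⟨M, ?_⟩ (mem_image_of_mem u hy)
    rintro _ ⟨w, hw, rfl⟩
    exact (le_abs_self _).trans (hM w (hsub hw))
  have hinf : 0 ≤ sInf (u '' Metric.ball x ε) := by
    refine Real.sInf_nonneg ?_
    rintro _ ⟨w, hw, rfl⟩
    exact hu w (hsub hw)
  have havg : 0 ≤ ⨍ w in Metric.ball x ε, u w := by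
    rw [setAverage_eq]
    exact smul_nonneg (inv_nonneg.2 measureReal_nonneg)
      (setIntegral_nonneg measurableSet_ball fun w hw => hu w (hsub hw))
  have h₁ : α / 2 * u y ≤ α / 2 * (sSup (u '' Metric.ball x ε) + sInf (u '' Metric.ball x ε)) :=
    mul_le_mul_of_nonneg_left (by linarith) (by linarith)
  have h₂ := mul_nonneg hβ havg
  have h₃ := mul_nonneg (sq_nonneg ε) (hf x hx)
  rw [hudpp x hx]
  linarith

theorem pow_mul_le_of_chain {c : ℝ} (hc : 0 ≤ c) {a : ℕ → ℝ} {m : ℕ}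
    (h : ∀ k < m, c * a (k + 1) ≤ a k) : c ^ m * a m ≤ a 0 := by
  induction m with
  | zero => simp
  | succ m ih =>
    calc c ^ (m + 1) * a (m + 1) = c ^ m * (c * a (m + 1)) := by ring
      _ ≤ c ^ m * a m := mul_le_mul_of_nonneg_left (h m m.lt_succ_self) (pow_nonneg hc m)
      _ ≤ a 0 := ih fun k hk => h k (hk.trans m.lt_succ_self)

/-- Lemma 3.4. If `u > 0` is a positive bounded Borel DPP solution,
`B_R(z) ⊆ Ω` and `x, y ∈ B_R(z)` with `|x − y| ≤ 10ε`, then `u x ≥ (α/2)^{20} u y`. -/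
theorem local_comparison
    (n : ℕ) (hn : 2 ≤ n) (Ω : Set (En n))
    (hΩopen : IsOpen Ω) (hΩbdd : Bornology.IsBounded Ω) (hΩconn : IsConnected Ω)
    (p : ℝ) (hp : 2 < p) (ε : ℝ) (hε : 0 < ε)
    (α β : ℝ) (hα : α = (p - 2) / (n + p)) (hβ : β = (n + 2) / (n + p))
    (f : En n → ℝ) (hfmeas : Measurable f) (hfbdd : ∃ M, ∀ x ∈ Ω, |f x| ≤ M)
    (hfpos : ∀ x ∈ Ω, 0 < f x)
    (u : En n → ℝ) (humeas : Measurable u)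
    (hubdd : ∃ M, ∀ x ∈ Ω ∪ bdryStrip n Ω ε, |u x| ≤ M)
    (hupos : ∀ x ∈ Ω ∪ bdryStrip n Ω ε, 0 < u x)
    (hudpp : SatisfiesDPP n α β ε Ω f u)
    (z : En n) (R : ℝ) (hR : 0 < R) (hball : Metric.ball z R ⊆ Ω)
    (x y : En n) (hx : x ∈ Metric.ball z R) (hy : y ∈ Metric.ball z R)
    (hxy : dist x y ≤ 10 * ε) :
    (α / 2) ^ 20 * u y ≤ u x := by
  have hnp : 0 < (n : ℝ) + p := by positivity
  have hα₀ : 0 ≤ α := hα ▸ div_nonneg (by linarith) hnp.le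
  have hβ₀ : 0 ≤ β := hβ ▸ div_nonneg (by positivity) hnp.le
  have hstep : ∀ k < 20, α / 2 * u (AffineMap.lineMap x y (((k + 1 : ℕ) : ℝ) / 20))
      ≤ u (AffineMap.lineMap x y ((k : ℝ) / 20)) := by
    intro k hk
    have hk' : (k : ℝ) ≤ 20 := by exact_mod_cast hk.le
    refine hudpp.mul_le_of_mem_ball hα₀ hβ₀ (fun w hw => (hfpos w hw).le) hubdd
      (fun w hw => (hupos w hw).le) (hball ?_) ?_
    · exact (convex_ball z R).lineMap_mem hx hy ⟨by positivity, by linarith⟩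
    · rw [Metric.mem_ball, dist_lineMap_lineMap, Real.dist_eq]
      have : ((k + 1 : ℕ) : ℝ) / 20 - (k : ℝ) / 20 = 1 / 20 := by push_cast; ring
      rw [this, abs_of_pos (by norm_num)]
      linarith
  simpa using pow_mul_le_of_chain (c := α / 2) (by linarith)
    (a := fun k : ℕ => u (AffineMap.lineMap x y ((k : ℝ) / 20))) hstep
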